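/- Let $(X_1, C_1, u_1)$ and $(X_2, C_2, u_2)$ be order unit spaces with strictly positive states $\varphi_1, \varphi_2$ and cross sections $\Sigma_i = \{x \in C_i^\circ : \varphi_i(x) = 1\}$. If $f : (\Sigma_1, d_H) \to (\Sigma_2, d_H)$ is an isometry that maps line segments to line segments, then $f$ has a unique continuous extension (with respect to the order unit norms) to a map from the norm closure $\overline{\Sigma}_1$ of $\Sigma_1$ into the norm closure $\overline{\Sigma}_2$ of $\Sigma_2$, and this extension is injective. -/

import Mathlib

namespace HilbertGeom

/-- An order unit space: a real vector space with an Archimedean cone `C` and order unit `u`. -/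
structure OrderUnitSpace (X : Type*) [AddCommGroup X] [Module ℝ X] where
  C : Set X
  u : X
  convex : Convex ℝ C
  smul_mem : ∀ ⦃c : ℝ⦄, 0 ≤ c → ∀ ⦃x : X⦄, x ∈ C → c • x ∈ C
  salient : ∀ ⦃x : X⦄, x ∈ C → -x ∈ C → x = 0
  archimedean : ∀ x y : X, y ∈ C → (∀ n : ℕ, 0 < n → y - (n : ℝ) • x ∈ C) → -x ∈ C
  u_mem : u ∈ C
  orderUnit : ∀ x : X, ∃ c : ℝ, 0 < c ∧ c • u - x ∈ C

namespace OrderUnitSpace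

variable {X : Type*} [AddCommGroup X] [Module ℝ X] (S : OrderUnitSpace X)

/-- The order unit norm `‖x‖_u = inf {c > 0 : -c•u ≤ x ≤ c•u}`. -/
noncomputable def onorm (x : X) : ℝ :=
  sInf {c : ℝ | 0 < c ∧ c • S.u - x ∈ S.C ∧ c • S.u + x ∈ S.C}

/-- The interior of the cone `C` with respect to the order unit norm. -/
def interiorC : Set X :=
  {x : X | ∃ ε > 0, ∀ y : X, S.onorm (y - x) < ε → y ∈ S.C}

/-- `M(x/y) = inf {β > 0 : x ≤_C β y}`. -/
noncomputable def M (x y : X) : ℝ := sInf {c : ℝ | 0 < c ∧ c • y - x ∈ S.C}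

/-- Birkhoff's version of Hilbert's metric. -/
noncomputable def dH (x y : X) : ℝ := Real.log (S.M x y * S.M y x)

/-- `φ` is a state: a linear functional with `φ u = 1`. -/
def IsState (φ : X →ₗ[ℝ] ℝ) : Prop := φ S.u = 1

/-- `φ` is strictly positive: `φ(C \ {0}) ⊆ (0, ∞)`. -/
def StrictlyPos (φ : X →ₗ[ℝ] ℝ) : Prop := ∀ x ∈ S.C, x ≠ 0 → 0 < φ x

/-- The cross section `Σ_φ = {x ∈ C° : φ x = 1}`. -/
def Sig (φ : X →ₗ[ℝ] ℝ) : Set X := {x | x ∈ S.interiorC ∧ φ x = 1}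

/-- `z` lies in the closure of `A` with respect to the order unit norm. -/
def InClosure (A : Set X) (z : X) : Prop := ∀ ε > 0, ∃ w ∈ A, S.onorm (w - z) < ε

/-- The relative boundary of `Σ_φ` (in the affine hyperplane `φ = 1`, w.r.t. the order
unit norm): since `Σ_φ` is relatively open this is its closure minus itself. -/
def relBoundary (φ : X →ₗ[ℝ] ℝ) : Set X :=
  {z : X | S.InClosure (S.Sig φ) z ∧ z ∉ S.Sig φ}

/-- The straight line through `x` and `y`. -/
def lineThrough (x y : X) : Set X := {z : X | ∃ t : ℝ, z = x + t • (y - x)}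

end OrderUnitSpace

end HilbertGeom

namespace HilbertGeom

open OrderUnitSpace

/-- Continuity of `g` on the set `A`, with respect to the order unit norms. -/
def ContOnWrt {X₁ : Type*} [AddCommGroup X₁] [Module ℝ X₁]
    {X₂ : Type*} [AddCommGroup X₂] [Module ℝ X₂]
    (S₁ : OrderUnitSpace X₁) (S₂ : OrderUnitSpace X₂)
    (g : X₁ → X₂) (A : Set X₁) : Prop :=
  ∀ z ∈ A, ∀ ε > 0, ∃ δ > 0, ∀ w ∈ A, S₁.onorm (w - z) < δ → S₂.onorm (g w - g z) < ε

namespace OrderUnitSpace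

section Order

variable {X : Type*} [AddCommGroup X] [Module ℝ X] (S : OrderUnitSpace X)

theorem add_mem {x y : X} (hx : x ∈ S.C) (hy : y ∈ S.C) : x + y ∈ S.C := by
  have h := S.smul_mem zero_le_two
    (S.convex hx hy (by norm_num : (0 : ℝ) ≤ 1 / 2) (by norm_num : (0 : ℝ) ≤ 1 / 2)
      (by norm_num))
  convert h using 1
  module

theorem zero_mem : (0 : X) ∈ S.C := by
  simpa using S.smul_mem le_rfl S.u_mem

theorem mem_of_forall_pos {w x : X} (hw : w ∈ S.C)
    (h : ∀ δ : ℝ, 0 < δ → δ • w + x ∈ S.C) : x ∈ S.C := by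
  have := S.archimedean (-x) w hw fun n hn => by
    have hn' : (0 : ℝ) < n := by exact_mod_cast hn
    convert S.smul_mem hn'.le (h (n : ℝ)⁻¹ (by positivity)) using 1
    rw [smul_add, smul_smul, mul_inv_cancel₀ hn'.ne']
    module
  simpa using this

theorem onorm_nonneg (x : X) : 0 ≤ S.onorm x :=
  Real.sInf_nonneg fun _ hc => hc.1.le

theorem onorm_le {x : X} {c : ℝ} (hc : 0 ≤ c) (h₁ : c • S.u - x ∈ S.C)
    (h₂ : c • S.u + x ∈ S.C) : S.onorm x ≤ c := by
  refine le_of_forall_pos_le_add fun δ hδ => csInf_le ⟨0, fun _ h => h.1.le⟩ ⟨by linarith, ?_, ?_⟩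
  · convert S.add_mem h₁ (S.smul_mem hδ.le S.u_mem) using 1
    module
  · convert S.add_mem h₂ (S.smul_mem hδ.le S.u_mem) using 1
    module

theorem mem_of_onorm_lt {x : X} {c : ℝ} (h : S.onorm x < c) :
    c • S.u - x ∈ S.C ∧ c • S.u + x ∈ S.C := by
  obtain ⟨a, ha, hax⟩ := S.orderUnit x
  obtain ⟨b, hb, hbx⟩ := S.orderUnit (-x)
  have hne : {c : ℝ | 0 < c ∧ c • S.u - x ∈ S.C ∧ c • S.u + x ∈ S.C}.Nonempty := by
    refine ⟨a + b, by linarith, ?_, ?_⟩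
    · convert S.add_mem hax (S.smul_mem hb.le S.u_mem) using 1
      module
    · convert S.add_mem hbx (S.smul_mem ha.le S.u_mem) using 1
      module
  obtain ⟨d, ⟨-, h₁, h₂⟩, hd⟩ := (csInf_lt_iff ⟨0, fun _ h => h.1.le⟩ hne).1 h
  have hu := S.smul_mem (sub_nonneg.2 hd.le) S.u_mem
  constructor
  · convert S.add_mem h₁ hu using 1
    module
  · convert S.add_mem h₂ hu using 1
    module

theorem onorm_smul_le (a : ℝ) (x : X) : S.onorm (a • x) ≤ |a| * S.onorm x := by
  have key : ∀ δ : ℝ, 0 < δ → S.onorm (a • x) ≤ |a| * (S.onorm x + δ) := fun δ hδ => by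
    obtain ⟨h₁, h₂⟩ := S.mem_of_onorm_lt (lt_add_of_pos_right (S.onorm x) hδ)
    have h₁' := S.smul_mem (abs_nonneg a) h₁
    have h₂' := S.smul_mem (abs_nonneg a) h₂
    have hn := S.onorm_nonneg x
    apply S.onorm_le (by positivity)
    · rcases abs_choice a with h | h <;> rw [h] at h₁' h₂' ⊢
      · convert h₁' using 1
        module
      · convert h₂' using 1
        module
    · rcases abs_choice a with h | h <;> rw [h] at h₁' h₂' ⊢
      · convert h₂' using 1
        module
      · convert h₁' using 1
        module
  refine le_of_forall_pos_le_add fun δ hδ => ?_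
  have hpos : 0 < |a| + 1 := by positivity
  have h := key (δ / (|a| + 1)) (by positivity)
  have : |a| * (δ / (|a| + 1)) ≤ δ := by
    rw [mul_div_assoc', div_le_iff₀ hpos]
    nlinarith
  linarith

theorem normedSpaceCore :
    letI : Norm X := ⟨S.onorm⟩
    NormedSpace.Core ℝ X :=
  letI : Norm X := ⟨S.onorm⟩
  { norm_nonneg := S.onorm_nonneg
    norm_smul := fun a x => by
      refine le_antisymm (S.onorm_smul_le a x) ?_
      rcases eq_or_ne a 0 with rfl | ha
      · simpa using S.onorm_nonneg _
      · have h := S.onorm_smul_le a⁻¹ (a • x)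
        rw [smul_smul, inv_mul_cancel₀ ha, one_smul, abs_inv] at h
        have ha' : 0 < |a| := abs_pos.2 ha
        calc |a| * S.onorm x ≤ |a| * (|a|⁻¹ * S.onorm (a • x)) := by gcongr
          _ = S.onorm (a • x) := by field_simp
    norm_triangle := fun x y => by
      refine le_of_forall_pos_le_add fun δ hδ => ?_
      obtain ⟨h₁, h₂⟩ := S.mem_of_onorm_lt (lt_add_of_pos_right (S.onorm x) (half_pos hδ))
      obtain ⟨h₃, h₄⟩ := S.mem_of_onorm_lt (lt_add_of_pos_right (S.onorm y) (half_pos hδ))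
      have hx := S.onorm_nonneg x
      have hy := S.onorm_nonneg y
      change S.onorm (x + y) ≤ S.onorm x + S.onorm y + δ
      apply S.onorm_le (by positivity)
      · convert S.add_mem h₁ h₃ using 1
        module
      · convert S.add_mem h₂ h₄ using 1
        module
    norm_eq_zero_iff := fun x => by
      constructor
      · intro h
        have h0 : ∀ δ : ℝ, 0 < δ → S.onorm x < δ := fun δ hδ => by
          change S.onorm x = 0 at h
          rwa [h]
        apply S.salient
        · exact S.mem_of_forall_pos S.u_mem fun δ hδ => (S.mem_of_onorm_lt (h0 δ hδ)).2
        · refine S.mem_of_forall_pos S.u_mem fun δ hδ => ?_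
          rw [← sub_eq_add_neg]
          exact (S.mem_of_onorm_lt (h0 δ hδ)).1
      · rintro rfl
        refine le_antisymm (S.onorm_le le_rfl ?_ ?_) (S.onorm_nonneg _) <;>
          simpa using S.zero_mem }

theorem mem_interiorC_iff {x : X} :
    x ∈ S.interiorC ↔ ∃ ε : ℝ, 0 < ε ∧ x - ε • S.u ∈ S.C := by
  constructor
  · rintro ⟨ε, hε, h⟩
    refine ⟨ε / 2, half_pos hε, h _ (lt_of_le_of_lt (b := ε / 2) ?_ (half_lt_self hε))⟩
    apply S.onorm_le (half_pos hε).le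
    · convert S.smul_mem hε.le S.u_mem using 1
      module
    · convert S.zero_mem using 1
      module
  · rintro ⟨ε, hε, h⟩
    refine ⟨ε, hε, fun y hy => ?_⟩
    convert S.add_mem h (S.mem_of_onorm_lt hy).2 using 1
    module

variable {S}

theorem mem_C_of_mem_interiorC {x : X} (hx : x ∈ S.interiorC) : x ∈ S.C := by
  obtain ⟨ε, hε, h⟩ := S.mem_interiorC_iff.1 hx
  convert S.add_mem h (S.smul_mem hε.le S.u_mem) using 1
  module

theorem smul_add_mem_interiorC {x y : X} {c : ℝ} (hc : 0 < c) (hx : x ∈ S.interiorC)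
    (hy : y ∈ S.C) : c • x + y ∈ S.interiorC := by
  obtain ⟨ε, hε, h⟩ := S.mem_interiorC_iff.1 hx
  refine S.mem_interiorC_iff.2 ⟨c * ε, by positivity, ?_⟩
  convert S.add_mem (S.smul_mem hc.le h) hy using 1
  module

variable (S) in
theorem u_mem_interiorC : S.u ∈ S.interiorC :=
  S.mem_interiorC_iff.2 ⟨1, one_pos, by simpa using S.zero_mem⟩

theorem exists_sub_smul_mem {x : X} (hx : x ∈ S.interiorC) (v : X) :
    ∃ ε : ℝ, 0 < ε ∧ x - ε • v ∈ S.C := by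
  obtain ⟨ε, hε, h⟩ := S.mem_interiorC_iff.1 hx
  obtain ⟨c, hc, hv⟩ := S.orderUnit v
  refine ⟨ε / c, by positivity, ?_⟩
  convert S.add_mem h (S.smul_mem (by positivity : 0 ≤ ε / c) hv) using 1
  rw [smul_sub, smul_smul, div_mul_cancel₀ _ hc.ne']
  module

theorem M_nonneg (v x : X) : 0 ≤ S.M v x := Real.sInf_nonneg fun _ h => h.1.le

theorem smul_sub_mem_of_M_le {x : X} (hx : x ∈ S.interiorC) {v : X} {c : ℝ}
    (h : S.M v x ≤ c) : c • x - v ∈ S.C := by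
  obtain ⟨ε, hε, hv⟩ := exists_sub_smul_mem hx v
  have hne : {c : ℝ | 0 < c ∧ c • x - v ∈ S.C}.Nonempty := by
    refine ⟨ε⁻¹, by positivity, ?_⟩
    convert S.smul_mem (inv_pos.2 hε).le hv using 1
    rw [smul_sub, smul_smul, inv_mul_cancel₀ hε.ne', one_smul]
  have hxC := mem_C_of_mem_interiorC hx
  refine S.mem_of_forall_pos hxC fun δ hδ => ?_
  obtain ⟨d, ⟨-, hd⟩, hdc⟩ := (csInf_lt_iff ⟨0, fun _ h => h.1.le⟩ hne).1
    (lt_of_le_of_lt h (lt_add_of_pos_right c hδ))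
  convert S.add_mem hd (S.smul_mem (sub_nonneg.2 hdc.le) hxC) using 1
  module

theorem M_le {x : X} (hx : x ∈ S.interiorC) {v : X} {c : ℝ} (hc : 0 ≤ c)
    (h : c • x - v ∈ S.C) : S.M v x ≤ c := by
  refine le_of_forall_pos_le_add fun δ hδ => csInf_le ⟨0, fun _ h => h.1.le⟩ ⟨by linarith, ?_⟩
  convert S.add_mem h (S.smul_mem hδ.le (mem_C_of_mem_interiorC hx)) using 1
  module

theorem M_add_le {x : X} (hx : x ∈ S.interiorC) (v w : X) :
    S.M (v + w) x ≤ S.M v x + S.M w x := by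
  apply M_le hx (add_nonneg (M_nonneg _ _) (M_nonneg _ _))
  convert S.add_mem (smul_sub_mem_of_M_le hx (le_refl (S.M v x)))
    (smul_sub_mem_of_M_le hx (le_refl (S.M w x))) using 1
  module

theorem M_smul_le {x : X} (hx : x ∈ S.interiorC) {a : ℝ} (ha : 0 ≤ a) (v : X) :
    S.M (a • v) x ≤ a * S.M v x := by
  apply M_le hx (mul_nonneg ha (M_nonneg _ _))
  convert S.smul_mem ha (smul_sub_mem_of_M_le hx (le_refl (S.M v x))) using 1
  module

theorem M_smul {x : X} (hx : x ∈ S.interiorC) {a : ℝ} (ha : 0 ≤ a) (v : X) :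
    S.M (a • v) x = a * S.M v x := by
  refine le_antisymm (M_smul_le hx ha v) ?_
  rcases ha.eq_or_lt with rfl | ha
  · simpa using M_nonneg _ _
  · have h := M_smul_le hx (inv_pos.2 ha).le (a • v)
    rw [smul_smul, inv_mul_cancel₀ ha.ne', one_smul] at h
    calc a * S.M v x ≤ a * (a⁻¹ * S.M (a • v) x) := by gcongr
      _ = S.M (a • v) x := by field_simp

variable {φ : X →ₗ[ℝ] ℝ}

theorem StrictlyPos.nonneg (hφ : S.StrictlyPos φ) {x : X} (hx : x ∈ S.C) : 0 ≤ φ x := by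
  rcases eq_or_ne x 0 with rfl | h
  · simp
  · exact (hφ x hx h).le

theorem M_pos (hφ : S.StrictlyPos φ) {x : X} (hx : x ∈ S.interiorC) {v : X} (hv : φ v = 0)
    (hv0 : v ≠ 0) : 0 < S.M v x := by
  refine (M_nonneg v x).lt_of_ne' fun h => ?_
  have := hφ _ (smul_sub_mem_of_M_le hx h.le) (by simpa using hv0)
  simp [hv] at this

theorem M_le_iff (hφ : S.StrictlyPos φ) {x : X} (hx : x ∈ S.Sig φ) {v : X} (hv : φ v = 0)
    {c : ℝ} : S.M v x ≤ c ↔ c • x - v ∈ S.C := by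
  refine ⟨smul_sub_mem_of_M_le hx.1, fun h => M_le hx.1 ?_ h⟩
  simpa [hv, hx.2] using hφ.nonneg h

theorem map_sub_eq_zero {x y : X} (hx : φ x = 1) (hy : φ y = 1) : φ (y - x) = 0 := by
  simp [hx, hy]

theorem M_neg_sub_le_one {x z : X} (hx : x ∈ S.interiorC) (hz : z ∈ S.C) :
    S.M (-(z - x)) x ≤ 1 :=
  M_le hx zero_le_one (by simpa using hz)

theorem M_neg_sub_lt_one_iff (hφ : S.StrictlyPos φ) {x z : X} (hx : x ∈ S.Sig φ)
    (hz : φ z = 1) : S.M (-(z - x)) x < 1 ↔ z ∈ S.Sig φ := by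
  have hv : φ (-(z - x)) = 0 := by simp [hx.2, hz]
  constructor
  · intro h
    refine ⟨?_, hz⟩
    convert smul_add_mem_interiorC (sub_pos.2 h) hx.1
      (smul_sub_mem_of_M_le hx.1 (le_refl (S.M (-(z - x)) x))) using 1
    module
  · intro h
    obtain ⟨ε, hε, hm⟩ := exists_sub_smul_mem h.1 x
    refine lt_of_le_of_lt ((M_le_iff hφ hx hv (c := 1 - ε)).2 ?_) (by linarith)
    convert hm using 1
    module

theorem dH_eq (hφ : S.StrictlyPos φ) {x y : X} (hx : x ∈ S.Sig φ) (hy : y ∈ S.Sig φ) :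
    S.dH x y = Real.log ((1 + S.M (y - x) x) / (1 - S.M (-(y - x)) x)) := by
  have hv : φ (y - x) = 0 := map_sub_eq_zero hx.2 hy.2
  have hv' : φ (-(y - x)) = 0 := by rw [map_neg, hv, neg_zero]
  have hα := (M_neg_sub_lt_one_iff hφ hx hy.2).2 hy
  have hβ := S.M_nonneg (y - x) x
  have h₁ : S.M y x = 1 + S.M (y - x) x := by
    have : {c : ℝ | 0 < c ∧ c • x - y ∈ S.C} = Set.Ici (1 + S.M (y - x) x) := by
      ext c
      have e : c • x - y = (c - 1) • x - (y - x) := by module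
      rw [Set.mem_ofPred_eq, e, ← M_le_iff hφ hx hv, Set.mem_Ici]
      constructor
      · rintro ⟨-, h⟩
        linarith
      · intro h
        constructor <;> linarith
    rw [M, this, csInf_Ici]
  have h₂ : S.M x y = (1 - S.M (-(y - x)) x)⁻¹ := by
    have : {c : ℝ | 0 < c ∧ c • y - x ∈ S.C} = Set.Ici (1 - S.M (-(y - x)) x)⁻¹ := by
      ext c
      have key : 0 < c → (c • y - x ∈ S.C ↔ (1 - S.M (-(y - x)) x)⁻¹ ≤ c) := fun hc => by
        have e : c • y - x = c • ((1 - c⁻¹) • x - -(y - x)) := by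
          rw [smul_sub, smul_smul, mul_sub, mul_inv_cancel₀ hc.ne']
          module
        have e' : c • y - x ∈ S.C ↔ (1 - c⁻¹) • x - -(y - x) ∈ S.C := by
          refine ⟨fun h => ?_, fun h => e ▸ S.smul_mem hc.le h⟩
          have h' := S.smul_mem (inv_pos.2 hc).le h
          rwa [e, smul_smul, inv_mul_cancel₀ hc.ne', one_smul] at h'
        rw [e', ← M_le_iff hφ hx hv', inv_le_comm₀ (by linarith) hc]
        constructor <;> intro h <;> linarith
      refine ⟨fun h => (key h.1).1 h.2, fun h => ?_⟩
      have hc : 0 < c := lt_of_lt_of_le (inv_pos.2 (by linarith)) h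
      exact ⟨hc, (key hc).2 h⟩
    rw [M, this, csInf_Ici]
  rw [dH, h₁, h₂, mul_comm, div_eq_mul_inv]

theorem convex_Sig (φ : X →ₗ[ℝ] ℝ) : Convex ℝ (S.Sig φ) := by
  intro x hx y hy a b ha hb hab
  refine ⟨?_, by simp [hx.2, hy.2, hab]⟩
  rcases ha.eq_or_lt with rfl | ha
  · obtain rfl : b = 1 := by linarith
    simpa using hy.1
  · exact smul_add_mem_interiorC ha hx.1 (S.smul_mem hb (mem_C_of_mem_interiorC hy.1))

end Order

section Isometry

variable {X₁ X₂ : Type*} [AddCommGroup X₁] [Module ℝ X₁] [AddCommGroup X₂] [Module ℝ X₂]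
  {S₁ : OrderUnitSpace X₁} {S₂ : OrderUnitSpace X₂} {φ₁ : X₁ →ₗ[ℝ] ℝ} {φ₂ : X₂ →ₗ[ℝ] ℝ}

theorem variation_eq_of_dH_eq (hφ₁ : S₁.StrictlyPos φ₁) (hφ₂ : S₂.StrictlyPos φ₂)
    {x y : X₁} (hx : x ∈ S₁.Sig φ₁) (hy : y ∈ S₁.Sig φ₁)
    {x' y' : X₂} (hx' : x' ∈ S₂.Sig φ₂) (hy' : y' ∈ S₂.Sig φ₂)
    (h : S₂.dH x' y' = S₁.dH x y) :
    (S₂.M (y' - x') x' + S₂.M (-(y' - x')) x') * (1 - S₁.M (-(y - x)) x) =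
      (S₁.M (y - x) x + S₁.M (-(y - x)) x) * (1 - S₂.M (-(y' - x')) x') := by
  have hα := sub_pos.2 ((M_neg_sub_lt_one_iff hφ₁ hx hy.2).2 hy)
  have hα' := sub_pos.2 ((M_neg_sub_lt_one_iff hφ₂ hx' hy'.2).2 hy')
  have hβ := S₁.M_nonneg (y - x) x
  have hβ' := S₂.M_nonneg (y' - x') x'
  rw [dH_eq hφ₁ hx hy, dH_eq hφ₂ hx' hy'] at h
  have h' := Real.log_injOn_pos (Set.mem_Ioi.2 (by positivity)) (Set.mem_Ioi.2 (by positivity)) h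
  rw [div_eq_div_iff hα'.ne' hα.ne'] at h'
  linarith

theorem injOn_of_dH_eq (hφ₁ : S₁.StrictlyPos φ₁) (hφ₂ : S₂.StrictlyPos φ₂) {f : X₁ → X₂}
    (hmaps : Set.MapsTo f (S₁.Sig φ₁) (S₂.Sig φ₂))
    (hiso : ∀ x ∈ S₁.Sig φ₁, ∀ y ∈ S₁.Sig φ₁, S₂.dH (f x) (f y) = S₁.dH x y) :
    Set.InjOn f (S₁.Sig φ₁) := by
  intro x hx y hy hxy
  by_contra hne
  have h := variation_eq_of_dH_eq hφ₁ hφ₂ hx hy (hmaps hx) (hmaps hy) (hiso x hx y hy)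
  have hpos := M_pos hφ₁ hx.1 (map_sub_eq_zero hx.2 hy.2) (sub_ne_zero.2 (Ne.symm hne))
  have hα := S₁.M_nonneg (-(y - x)) x
  have h0 : S₂.M 0 (f x) = 0 := by
    simpa using M_smul (hmaps hx).1 (le_refl (0 : ℝ)) 0
  simp only [← hxy, sub_self, neg_zero, h0] at h
  linarith

/-- The explicit projective formula for the extension along rays from `x`: on each ray the
position of the image of `z` is recovered from the image of the midpoint of `x` and `z`. -/
noncomputable def rayExtension (S₁ : OrderUnitSpace X₁) (S₂ : OrderUnitSpace X₂) (f : X₁ → X₂)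
    (x z : X₁) : X₂ :=
  f x + ((2 - S₁.M (-(z - x)) x) /
    (1 - S₁.M (-(z - x)) x + S₂.M (-(f (midpoint ℝ x z) - f x)) (f x))) •
      (f (midpoint ℝ x z) - f x)

theorem midpoint_sub_self (x z : X₁) : midpoint ℝ x z - x = (1 / 2 : ℝ) • (z - x) := by
  rw [midpoint_eq_smul_add]
  norm_num
  module

theorem midpoint_mem_Sig {x z : X₁} (hx : x ∈ S₁.Sig φ₁) (hz : z ∈ S₁.C) (hz' : φ₁ z = 1) :
    midpoint ℝ x z ∈ S₁.Sig φ₁ := by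
  rw [midpoint_eq_smul_add, smul_add]
  refine ⟨smul_add_mem_interiorC (by norm_num) hx.1 (S₁.smul_mem (by norm_num) hz), ?_⟩
  simp [hx.2, hz']
  norm_num

theorem image_midpoint_sub_ne_zero {Y : Type*} [AddGroup Y] {f : X₁ → Y}
    (hinj : Set.InjOn f (S₁.Sig φ₁))
    {x z : X₁} (hx : x ∈ S₁.Sig φ₁) (hz : z ∈ S₁.C) (hz' : φ₁ z = 1) (hne : z ≠ x) :
    f (midpoint ℝ x z) - f x ≠ 0 := by
  intro h
  have h' := hinj (midpoint_mem_Sig hx hz hz') hx (sub_eq_zero.1 h)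
  rw [← sub_eq_zero, midpoint_sub_self] at h'
  simp [sub_eq_zero, hne] at h'

theorem rayExtension_denom_pos {f : X₁ → X₂} (hφ₂ : S₂.StrictlyPos φ₂)
    (hmaps : Set.MapsTo f (S₁.Sig φ₁) (S₂.Sig φ₂)) (hinj : Set.InjOn f (S₁.Sig φ₁))
    {x z : X₁} (hx : x ∈ S₁.Sig φ₁) (hz : z ∈ S₁.C) (hz' : φ₁ z = 1) :
    0 < 1 - S₁.M (-(z - x)) x + S₂.M (-(f (midpoint ℝ x z) - f x)) (f x) := by
  have hα := M_neg_sub_le_one hx.1 hz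
  rcases eq_or_ne z x with rfl | hne
  · have h0 : S₁.M 0 z = 0 := by
      simpa using M_smul hx.1 (le_refl (0 : ℝ)) 0
    have := S₂.M_nonneg (-(f (midpoint ℝ z z) - f z)) (f z)
    rw [sub_self, neg_zero, h0]
    linarith
  · have hm := hmaps (midpoint_mem_Sig hx hz hz')
    have := M_pos hφ₂ (hmaps hx).1 (v := -(f (midpoint ℝ x z) - f x))
      (by rw [map_neg, map_sub_eq_zero (hmaps hx).2 hm.2, neg_zero])
      (neg_ne_zero.2 (image_midpoint_sub_ne_zero hinj hx hz hz' hne))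
    linarith

theorem rayExtension_eq (hφ₁ : S₁.StrictlyPos φ₁) (hφ₂ : S₂.StrictlyPos φ₂) {f : X₁ → X₂}
    (hmaps : Set.MapsTo f (S₁.Sig φ₁) (S₂.Sig φ₂))
    (hiso : ∀ x ∈ S₁.Sig φ₁, ∀ y ∈ S₁.Sig φ₁, S₂.dH (f x) (f y) = S₁.dH x y)
    (hseg : ∀ x ∈ S₁.Sig φ₁, ∀ y ∈ S₁.Sig φ₁,
      f '' segment ℝ x y = segment ℝ (f x) (f y))
    {x z : X₁} (hx : x ∈ S₁.Sig φ₁) (hz : z ∈ S₁.Sig φ₁) :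
    rayExtension S₁ S₂ f x z = f z := by
  have hinj := injOn_of_dH_eq hφ₁ hφ₂ hmaps hiso
  have hzC := mem_C_of_mem_interiorC hz.1
  rcases eq_or_ne z x with rfl | hne
  · simp [rayExtension]
  have hm := midpoint_mem_Sig hx hzC hz.2
  have hden := rayExtension_denom_pos hφ₂ hmaps hinj hx hzC hz.2
  have hw := image_midpoint_sub_ne_zero hinj hx hzC hz.2 hne
  have hmem : f (midpoint ℝ x z) ∈ segment ℝ (f x) (f z) := by
    rw [← hseg x hx z hz]
    exact Set.mem_image_of_mem f (midpoint_mem_segment x z)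
  rw [segment_eq_image'] at hmem
  obtain ⟨τ, ⟨hτ, -⟩, hτm⟩ := hmem
  have hwτ : f (midpoint ℝ x z) - f x = τ • (f z - f x) := by
    rw [← hτm]
    simp
  have h₁ := variation_eq_of_dH_eq hφ₁ hφ₂ hx hz (hmaps hx) (hmaps hz) (hiso x hx z hz)
  have h₂ := variation_eq_of_dH_eq hφ₁ hφ₂ hx hm (hmaps hx) (hmaps hm) (hiso x hx _ hm)
  have hhalf : (0 : ℝ) ≤ 1 / 2 := by norm_num
  rw [hwτ, midpoint_sub_self, ← smul_neg, ← smul_neg, M_smul hx.1 hhalf, M_smul hx.1 hhalf,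
    M_smul (hmaps hx).1 hτ, M_smul (hmaps hx).1 hτ] at h₂
  rw [hwτ, ← smul_neg, M_smul (hmaps hx).1 hτ] at hden
  have hv' : φ₂ (f z - f x) = 0 := map_sub_eq_zero (hmaps hx).2 (hmaps hz).2
  have hv'0 : f z - f x ≠ 0 := by
    intro h
    rw [hwτ, h, smul_zero] at hw
    exact hw rfl
  have hN := add_pos_of_pos_of_nonneg
    (M_pos hφ₁ hx.1 (map_sub_eq_zero hx.2 hz.2) (sub_ne_zero.2 hne)) (S₁.M_nonneg (-(z - x)) x)
  have hN' := add_pos_of_pos_of_nonneg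
    (M_pos hφ₂ (hmaps hx).1 hv' hv'0) (S₂.M_nonneg (-(f z - f x)) (f x))
  rw [rayExtension, hwτ, ← smul_neg, M_smul (hmaps hx).1 hτ, smul_smul]
  set α := S₁.M (-(z - x)) x
  set α' := S₂.M (-(f z - f x)) (f x)
  set β := S₁.M (z - x) x
  set β' := S₂.M (f z - f x) (f x)
  have key : τ * (2 - α) = 1 - α + τ * α' := by
    have : (β + α) * ((β' + α') * (τ * (2 - α) - (1 - α + τ * α'))) = 0 := by
      linear_combination (β + α) * (-(1 - τ * α')) * h₁ + (β + α) * (2 * (1 - α')) * h₂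
    rcases mul_eq_zero.1 this with h | h
    · exact absurd h hN.ne'
    · rcases mul_eq_zero.1 h with h | h
      · exact absurd h hN'.ne'
      · linarith
  rw [div_mul_eq_mul_div, mul_comm, key, div_self hden.ne', one_smul]
  abel

end Isometry

section Topology

variable {X : Type*} [NormedAddCommGroup X] [NormedSpace ℝ X] {S : OrderUnitSpace X}
  {φ : X →ₗ[ℝ] ℝ}

theorem inClosure_iff (hS : ∀ x, S.onorm x = ‖x‖) {A : Set X} {z : X} :
    S.InClosure A z ↔ z ∈ closure A := by
  simp only [InClosure, Metric.mem_closure_iff, hS, dist_eq_norm, norm_sub_rev z]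

theorem norm_smul_u_add_mem (hS : ∀ x, S.onorm x = ‖x‖) {x : X} {c : ℝ} (h : ‖x‖ ≤ c) :
    c • S.u + x ∈ S.C := by
  refine S.mem_of_forall_pos S.u_mem fun δ hδ => ?_
  convert (S.mem_of_onorm_lt (x := x) (c := c + δ) (by rw [hS]; linarith)).2 using 1
  module

theorem isClosed_C (hS : ∀ x, S.onorm x = ‖x‖) : IsClosed S.C := by
  refine isClosed_of_closure_subset fun z hz => S.mem_of_forall_pos S.u_mem fun δ hδ => ?_
  obtain ⟨w, hw, hwz⟩ := Metric.mem_closure_iff.1 hz δ hδ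
  rw [dist_eq_norm] at hwz
  convert S.add_mem (norm_smul_u_add_mem hS hwz.le) hw using 1
  module

theorem continuous_of_isState (hS : ∀ x, S.onorm x = ‖x‖) (hφ : S.StrictlyPos φ)
    (hstate : S.IsState φ) : Continuous φ := by
  refine (LipschitzWith.of_le_add fun x y => ?_).continuous
  have h := hφ.nonneg (norm_smul_u_add_mem hS (le_refl ‖y - x‖))
  rw [IsState] at hstate
  simp only [map_add, map_smul, map_sub, hstate, smul_eq_mul, mul_one] at h
  rw [dist_eq_norm, norm_sub_rev]
  linarith

theorem continuous_M (hS : ∀ x, S.onorm x = ‖x‖) {x : X} (hx : x ∈ S.interiorC) :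
    Continuous fun v => S.M v x := by
  refine (LipschitzWith.of_le_add_mul (S.M S.u x).toNNReal fun v w => ?_).continuous
  rw [Real.coe_toNNReal _ (M_nonneg _ _), dist_eq_norm]
  have h₁ := M_add_le hx w (v - w)
  rw [add_sub_cancel] at h₁
  have h₂ : S.M (v - w) x ≤ ‖v - w‖ * S.M S.u x := by
    apply M_le hx (mul_nonneg (norm_nonneg _) (M_nonneg _ _))
    convert S.add_mem
      (S.smul_mem (norm_nonneg (v - w)) (smul_sub_mem_of_M_le hx (le_refl (S.M S.u x))))
      (norm_smul_u_add_mem hS (norm_neg (v - w)).le) using 1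
    module
  linarith

theorem exists_norm_le_mul_M (hS : ∀ x, S.onorm x = ‖x‖) {x : X} (hx : x ∈ S.interiorC) :
    ∃ R : ℝ, ∀ v, ‖v‖ ≤ R * (S.M v x + S.M (-v) x) := by
  obtain ⟨R, hR, hRx⟩ := S.orderUnit x
  refine ⟨R, fun v => ?_⟩
  have hα := S.M_nonneg (-v) x
  have hβ := S.M_nonneg v x
  have hxC := mem_C_of_mem_interiorC hx
  have hsum := S.smul_mem (add_nonneg hβ hα) hRx
  rw [← hS]
  apply S.onorm_le (by positivity)
  · convert S.add_mem hsum (S.add_mem (S.smul_mem hα hxC)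
      (smul_sub_mem_of_M_le hx (le_refl (S.M v x)))) using 1
    module
  · convert S.add_mem hsum (S.add_mem (S.smul_mem hβ hxC)
      (smul_sub_mem_of_M_le hx (le_refl (S.M (-v) x)))) using 1
    module

theorem closure_Sig_subset (hS : ∀ x, S.onorm x = ‖x‖) (hφ : S.StrictlyPos φ)
    (hstate : S.IsState φ) : closure (S.Sig φ) ⊆ {z | z ∈ S.C ∧ φ z = 1} :=
  closure_minimal (fun _ hx => ⟨mem_C_of_mem_interiorC hx.1, hx.2⟩)
    ((isClosed_C hS).inter
      (isClosed_singleton.preimage (continuous_of_isState hS hφ hstate)))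

variable {X₁ X₂ : Type*} [NormedAddCommGroup X₁] [NormedSpace ℝ X₁] [NormedAddCommGroup X₂]
  [NormedSpace ℝ X₂] {S₁ : OrderUnitSpace X₁} {S₂ : OrderUnitSpace X₂}
  {φ₁ : X₁ →ₗ[ℝ] ℝ} {φ₂ : X₂ →ₗ[ℝ] ℝ}

theorem contOnWrt_iff (hS₁ : ∀ x, S₁.onorm x = ‖x‖) (hS₂ : ∀ x, S₂.onorm x = ‖x‖)
    {g : X₁ → X₂} {A : Set X₁} : ContOnWrt S₁ S₂ g A ↔ ContinuousOn g A := by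
  simp only [ContOnWrt, Metric.continuousOn_iff, hS₁, hS₂, dist_eq_norm]

theorem continuousOn_of_dH_eq (hS₁ : ∀ x, S₁.onorm x = ‖x‖) (hS₂ : ∀ x, S₂.onorm x = ‖x‖)
    (hφ₁ : S₁.StrictlyPos φ₁) (hφ₂ : S₂.StrictlyPos φ₂) {f : X₁ → X₂}
    (hmaps : Set.MapsTo f (S₁.Sig φ₁) (S₂.Sig φ₂))
    (hiso : ∀ x ∈ S₁.Sig φ₁, ∀ y ∈ S₁.Sig φ₁, S₂.dH (f x) (f y) = S₁.dH x y) :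
    ContinuousOn f (S₁.Sig φ₁) := by
  intro x hx
  obtain ⟨R, hR⟩ := exists_norm_le_mul_M hS₂ (hmaps hx).1
  have hM := continuous_M hS₁ hx.1
  have h0 : S₁.M 0 x = 0 := by
    simpa using M_smul hx.1 (le_refl (0 : ℝ)) 0
  have hlim : Filter.Tendsto (fun y => |R| * ((S₁.M (y - x) x + S₁.M (-(y - x)) x) /
      (1 - S₁.M (-(y - x)) x))) (nhdsWithin x (S₁.Sig φ₁)) (nhds 0) := by
    have hα : Continuous fun y => S₁.M (-(y - x)) x := hM.comp (by fun_prop)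
    have hβ : Continuous fun y => S₁.M (y - x) x := hM.comp (by fun_prop)
    have : ContinuousAt (fun y => |R| * ((S₁.M (y - x) x + S₁.M (-(y - x)) x) /
        (1 - S₁.M (-(y - x)) x))) x :=
      continuousAt_const.mul ((hβ.add hα).continuousAt.div
        (continuous_const.sub hα).continuousAt (by simp [h0]))
    have h := this.tendsto
    simp only [sub_self, neg_zero, h0, add_zero, zero_div, mul_zero] at h
    exact h.mono_left nhdsWithin_le_nhds
  rw [ContinuousWithinAt, tendsto_iff_norm_sub_tendsto_zero]
  refine squeeze_zero' (Filter.Eventually.of_forall fun _ => norm_nonneg _) ?_ hlim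
  filter_upwards [self_mem_nhdsWithin] with y hy
  have h := variation_eq_of_dH_eq hφ₁ hφ₂ hx hy (hmaps hx) (hmaps hy) (hiso x hx y hy)
  have hα := sub_pos.2 ((M_neg_sub_lt_one_iff hφ₁ hx hy.2).2 hy)
  have hα' := S₂.M_nonneg (-(f y - f x)) (f x)
  have hβ' := S₂.M_nonneg (f y - f x) (f x)
  have hN := add_nonneg (S₁.M_nonneg (y - x) x) (S₁.M_nonneg (-(y - x)) x)
  calc ‖f y - f x‖ ≤ R * (S₂.M (f y - f x) (f x) + S₂.M (-(f y - f x)) (f x)) := hR _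
    _ ≤ |R| * (S₂.M (f y - f x) (f x) + S₂.M (-(f y - f x)) (f x)) := by
      gcongr
      exact le_abs_self R
    _ ≤ _ := by
      gcongr
      rw [le_div_iff₀ hα, h]
      nlinarith

theorem continuousOn_rayExtension (hS₁ : ∀ x, S₁.onorm x = ‖x‖)
    (hS₂ : ∀ x, S₂.onorm x = ‖x‖) (hφ₁ : S₁.StrictlyPos φ₁) (hφ₂ : S₂.StrictlyPos φ₂)
    (hstate₁ : S₁.IsState φ₁) {f : X₁ → X₂} (hmaps : Set.MapsTo f (S₁.Sig φ₁) (S₂.Sig φ₂))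
    (hiso : ∀ x ∈ S₁.Sig φ₁, ∀ y ∈ S₁.Sig φ₁, S₂.dH (f x) (f y) = S₁.dH x y)
    {x : X₁} (hx : x ∈ S₁.Sig φ₁) :
    ContinuousOn (rayExtension S₁ S₂ f x) (closure (S₁.Sig φ₁)) := by
  have hsub := closure_Sig_subset hS₁ hφ₁ hstate₁
  have hw : ContinuousOn (fun z => f (midpoint ℝ x z) - f x) (closure (S₁.Sig φ₁)) := by
    have hmid : Continuous fun z => midpoint ℝ x z := by
      simp only [midpoint_eq_smul_add]
      fun_prop
    exact ((continuousOn_of_dH_eq hS₁ hS₂ hφ₁ hφ₂ hmaps hiso).comp hmid.continuousOn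
      fun z hz => midpoint_mem_Sig hx (hsub hz).1 (hsub hz).2).sub continuousOn_const
  have hα : ContinuousOn (fun z => S₁.M (-(z - x)) x) (closure (S₁.Sig φ₁)) :=
    ((continuous_M hS₁ hx.1).comp (by fun_prop : Continuous fun z => -(z - x))).continuousOn
  have hα' : ContinuousOn (fun z => S₂.M (-(f (midpoint ℝ x z) - f x)) (f x))
      (closure (S₁.Sig φ₁)) :=
    (continuous_M hS₂ (hmaps hx).1).comp_continuousOn hw.neg
  refine continuousOn_const.add (ContinuousOn.smul (ContinuousOn.div (continuousOn_const.sub hα)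
    ((continuousOn_const.sub hα).add hα') fun z hz => ?_) hw)
  exact (rayExtension_denom_pos hφ₂ hmaps (injOn_of_dH_eq hφ₁ hφ₂ hmaps hiso) hx
    (hsub hz).1 (hsub hz).2).ne'

end Topology

section Injectivity

variable {X₁ X₂ : Type*} [AddCommGroup X₁] [Module ℝ X₁] [AddCommGroup X₂] [Module ℝ X₂]
  {S₁ : OrderUnitSpace X₁} {S₂ : OrderUnitSpace X₂} {φ₁ : X₁ →ₗ[ℝ] ℝ} {φ₂ : X₂ →ₗ[ℝ] ℝ}

theorem M_neg_sub_eq_one (hφ₁ : S₁.StrictlyPos φ₁) {x z : X₁} (hx : x ∈ S₁.Sig φ₁)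
    (hz : z ∈ S₁.C) (hz' : φ₁ z = 1) (hzS : z ∉ S₁.Sig φ₁) : S₁.M (-(z - x)) x = 1 :=
  (M_neg_sub_le_one hx.1 hz).eq_of_not_lt (mt (M_neg_sub_lt_one_iff hφ₁ hx hz').1 hzS)

theorem rayExtension_sub (hφ₁ : S₁.StrictlyPos φ₁) (f : X₁ → X₂) {x z : X₁}
    (hx : x ∈ S₁.Sig φ₁) (hz : z ∈ S₁.C) (hz' : φ₁ z = 1) (hzS : z ∉ S₁.Sig φ₁) :
    rayExtension S₁ S₂ f x z - f x =
      (S₂.M (-(f (midpoint ℝ x z) - f x)) (f x))⁻¹ • (f (midpoint ℝ x z) - f x) := by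
  rw [rayExtension, M_neg_sub_eq_one hφ₁ hx hz hz' hzS, add_sub_cancel_left]
  norm_num

theorem rayExtension_notMem (hφ₁ : S₁.StrictlyPos φ₁) (hφ₂ : S₂.StrictlyPos φ₂) {f : X₁ → X₂}
    (hmaps : Set.MapsTo f (S₁.Sig φ₁) (S₂.Sig φ₂)) (hinj : Set.InjOn f (S₁.Sig φ₁))
    {x z : X₁} (hx : x ∈ S₁.Sig φ₁) (hz : z ∈ S₁.C) (hz' : φ₁ z = 1) (hzS : z ∉ S₁.Sig φ₁) :
    rayExtension S₁ S₂ f x z ∉ S₂.Sig φ₂ := by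
  intro h
  have hlt := (M_neg_sub_lt_one_iff hφ₂ (hmaps hx) h.2).2 h
  have hden := rayExtension_denom_pos hφ₂ hmaps hinj hx hz hz'
  rw [M_neg_sub_eq_one hφ₁ hx hz hz' hzS, sub_self, zero_add] at hden
  rw [rayExtension_sub hφ₁ f hx hz hz' hzS, ← smul_neg,
    M_smul (hmaps hx).1 (inv_pos.2 hden).le, inv_mul_cancel₀ hden.ne'] at hlt
  exact lt_irrefl _ hlt

theorem eq_of_image_midpoint_sub_eq_smul (hφ₁ : S₁.StrictlyPos φ₁) {f : X₁ → X₂}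
    (hinj : Set.InjOn f (S₁.Sig φ₁))
    (hseg : ∀ x ∈ S₁.Sig φ₁, ∀ y ∈ S₁.Sig φ₁,
      f '' segment ℝ x y = segment ℝ (f x) (f y))
    {x z z' : X₁} (hx : x ∈ S₁.Sig φ₁)
    (hz : z ∈ S₁.C) (hz1 : φ₁ z = 1) (hzS : z ∉ S₁.Sig φ₁)
    (hz' : z' ∈ S₁.C) (hz1' : φ₁ z' = 1) (hzS' : z' ∉ S₁.Sig φ₁)
    {c : ℝ} (hc0 : 0 ≤ c) (hc1 : c ≤ 1)
    (h : f (midpoint ℝ x z) - f x = c • (f (midpoint ℝ x z') - f x)) : z = z' := by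
  have hm := midpoint_mem_Sig hx hz hz1
  have hm' := midpoint_mem_Sig hx hz' hz1'
  have hmem : f (midpoint ℝ x z) ∈ f '' segment ℝ x (midpoint ℝ x z') := by
    rw [hseg x hx _ hm', segment_eq_image']
    exact ⟨c, ⟨hc0, hc1⟩, by simp [← h]⟩
  obtain ⟨p, hp, hpm⟩ := hmem
  obtain rfl := hinj ((convex_Sig φ₁).segment_subset hx hm' hp) hm hpm
  rw [segment_eq_image'] at hp
  obtain ⟨s, ⟨hs, -⟩, hsp⟩ := hp
  have hsub : z - x = s • (z' - x) := by
    have : midpoint ℝ x z - x = s • (midpoint ℝ x z' - x) := by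
      rw [← hsp]
      simp
    rw [midpoint_sub_self, midpoint_sub_self, smul_comm] at this
    exact smul_right_injective X₁ (by norm_num : (1 / 2 : ℝ) ≠ 0) this
  have hα := M_neg_sub_eq_one hφ₁ hx hz hz1 hzS
  rw [hsub, ← smul_neg, M_smul hx.1 hs, M_neg_sub_eq_one hφ₁ hx hz' hz1' hzS', mul_one] at hα
  rw [hα, one_smul] at hsub
  exact sub_left_injective hsub

theorem injOn_rayExtension (hφ₁ : S₁.StrictlyPos φ₁) (hφ₂ : S₂.StrictlyPos φ₂) {f : X₁ → X₂}
    (hmaps : Set.MapsTo f (S₁.Sig φ₁) (S₂.Sig φ₂))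
    (hiso : ∀ x ∈ S₁.Sig φ₁, ∀ y ∈ S₁.Sig φ₁, S₂.dH (f x) (f y) = S₁.dH x y)
    (hseg : ∀ x ∈ S₁.Sig φ₁, ∀ y ∈ S₁.Sig φ₁,
      f '' segment ℝ x y = segment ℝ (f x) (f y))
    {x : X₁} (hx : x ∈ S₁.Sig φ₁) :
    Set.InjOn (rayExtension S₁ S₂ f x) {z | z ∈ S₁.C ∧ φ₁ z = 1} := by
  have hinj := injOn_of_dH_eq hφ₁ hφ₂ hmaps hiso
  have hext : ∀ z ∈ S₁.Sig φ₁, rayExtension S₁ S₂ f x z = f z := fun z hz =>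
    rayExtension_eq hφ₁ hφ₂ hmaps hiso hseg hx hz
  rintro z ⟨hz, hz1⟩ z' ⟨hz', hz1'⟩ h
  by_cases hzS : z ∈ S₁.Sig φ₁ <;> by_cases hzS' : z' ∈ S₁.Sig φ₁
  · rw [hext z hzS, hext z' hzS'] at h
    exact hinj hzS hzS' h
  · refine absurd ?_ (rayExtension_notMem hφ₁ hφ₂ hmaps hinj hx hz' hz1' hzS')
    rw [← h, hext z hzS]
    exact hmaps hzS
  · refine absurd ?_ (rayExtension_notMem hφ₁ hφ₂ hmaps hinj hx hz hz1 hzS)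
    rw [h, hext z' hzS']
    exact hmaps hzS'
  · have hd := rayExtension_denom_pos hφ₂ hmaps hinj hx hz hz1
    have hd' := rayExtension_denom_pos hφ₂ hmaps hinj hx hz' hz1'
    rw [M_neg_sub_eq_one hφ₁ hx hz hz1 hzS, sub_self, zero_add] at hd
    rw [M_neg_sub_eq_one hφ₁ hx hz' hz1' hzS', sub_self, zero_add] at hd'
    have hw := rayExtension_sub (S₂ := S₂) hφ₁ f hx hz hz1 hzS
    rw [h, rayExtension_sub hφ₁ f hx hz' hz1' hzS'] at hw
    set a := S₂.M (-(f (midpoint ℝ x z) - f x)) (f x)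
    set a' := S₂.M (-(f (midpoint ℝ x z') - f x)) (f x)
    rcases le_total a a' with haa | haa
    · refine eq_of_image_midpoint_sub_eq_smul hφ₁ hinj hseg hx hz hz1 hzS hz' hz1' hzS'
        (c := a / a') (by positivity) ((div_le_one hd').2 haa) ?_
      rw [div_eq_mul_inv, mul_smul, hw, smul_smul, mul_inv_cancel₀ hd.ne', one_smul]
    · refine (eq_of_image_midpoint_sub_eq_smul hφ₁ hinj hseg hx hz' hz1' hzS' hz hz1 hzS
        (c := a' / a) (by positivity) ((div_le_one hd).2 haa) ?_).symm
      rw [div_eq_mul_inv, mul_smul, ← hw, smul_smul, mul_inv_cancel₀ hd'.ne', one_smul]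

end Injectivity

section Extension

variable {X₁ X₂ : Type*} [NormedAddCommGroup X₁] [NormedSpace ℝ X₁] [NormedAddCommGroup X₂]
  [NormedSpace ℝ X₂] {S₁ : OrderUnitSpace X₁} {S₂ : OrderUnitSpace X₂}
  {φ₁ : X₁ →ₗ[ℝ] ℝ} {φ₂ : X₂ →ₗ[ℝ] ℝ}

theorem exists_unique_extension_of_onorm_eq_norm
    (hS₁ : ∀ x, S₁.onorm x = ‖x‖) (hS₂ : ∀ x, S₂.onorm x = ‖x‖)
    (hstate₁ : S₁.IsState φ₁) (hpos₁ : S₁.StrictlyPos φ₁) (hpos₂ : S₂.StrictlyPos φ₂)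
    {f : X₁ → X₂} (hmaps : Set.MapsTo f (S₁.Sig φ₁) (S₂.Sig φ₂))
    (hiso : ∀ x ∈ S₁.Sig φ₁, ∀ y ∈ S₁.Sig φ₁, S₂.dH (f x) (f y) = S₁.dH x y)
    (hseg : ∀ x ∈ S₁.Sig φ₁, ∀ y ∈ S₁.Sig φ₁,
      f '' segment ℝ x y = segment ℝ (f x) (f y)) :
    ∃ g : X₁ → X₂,
      ((∀ x ∈ S₁.Sig φ₁, g x = f x) ∧
        Set.MapsTo g {z | S₁.InClosure (S₁.Sig φ₁) z} {z | S₂.InClosure (S₂.Sig φ₂) z} ∧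
        ContOnWrt S₁ S₂ g {z | S₁.InClosure (S₁.Sig φ₁) z} ∧
        Set.InjOn g {z | S₁.InClosure (S₁.Sig φ₁) z}) ∧
      ∀ g' : X₁ → X₂, (∀ x ∈ S₁.Sig φ₁, g' x = f x) →
        Set.MapsTo g' {z | S₁.InClosure (S₁.Sig φ₁) z} {z | S₂.InClosure (S₂.Sig φ₂) z} →
        ContOnWrt S₁ S₂ g' {z | S₁.InClosure (S₁.Sig φ₁) z} →
        Set.EqOn g g' {z | S₁.InClosure (S₁.Sig φ₁) z} := by
  simp only [inClosure_iff hS₁, inClosure_iff hS₂, contOnWrt_iff hS₁ hS₂, Set.ofPred_mem_eq]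
  have hu : S₁.u ∈ S₁.Sig φ₁ := ⟨S₁.u_mem_interiorC, hstate₁⟩
  have hext : ∀ z ∈ S₁.Sig φ₁, rayExtension S₁ S₂ f S₁.u z = f z := fun z hz =>
    rayExtension_eq hpos₁ hpos₂ hmaps hiso hseg hu hz
  have hcont := continuousOn_rayExtension hS₁ hS₂ hpos₁ hpos₂ hstate₁ hmaps hiso hu
  refine ⟨rayExtension S₁ S₂ f S₁.u, ⟨hext, ?_, hcont, ?_⟩, fun g' hg' _ hc' => ?_⟩
  · exact Set.MapsTo.closure_of_continuousOn (hmaps.congr fun z hz => (hext z hz).symm) hcont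
  · exact (injOn_rayExtension hpos₁ hpos₂ hmaps hiso hseg hu).mono
      (closure_Sig_subset hS₁ hpos₁ hstate₁)
  · exact Set.EqOn.of_subset_closure (fun z hz => (hext z hz).trans (hg' z hz).symm) hcont hc'
      subset_closure subset_rfl

end Extension

end OrderUnitSpace

/-- If `f : (Σ₁, d_H) → (Σ₂, d_H)` is an isometry mapping line segments
to line segments, then `f` has a unique continuous extension (with respect to the order
unit norms) to a map from the norm closure of `Σ₁` into the norm closure of `Σ₂`, and
this extension is injective. -/
theorem isometry_extends_continuously_injectively_to_closure
    {X₁ : Type*} [AddCommGroup X₁] [Module ℝ X₁]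
    {X₂ : Type*} [AddCommGroup X₂] [Module ℝ X₂]
    (S₁ : OrderUnitSpace X₁) (S₂ : OrderUnitSpace X₂)
    (φ₁ : X₁ →ₗ[ℝ] ℝ) (φ₂ : X₂ →ₗ[ℝ] ℝ)
    (hstate₁ : S₁.IsState φ₁) (hpos₁ : S₁.StrictlyPos φ₁)
    (hstate₂ : S₂.IsState φ₂) (hpos₂ : S₂.StrictlyPos φ₂)
    (f : X₁ → X₂) (hmaps : Set.MapsTo f (S₁.Sig φ₁) (S₂.Sig φ₂))
    (hiso : ∀ x ∈ S₁.Sig φ₁, ∀ y ∈ S₁.Sig φ₁, S₂.dH (f x) (f y) = S₁.dH x y)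
    (hseg : ∀ x ∈ S₁.Sig φ₁, ∀ y ∈ S₁.Sig φ₁,
      f '' segment ℝ x y = segment ℝ (f x) (f y)) :
    ∃ g : X₁ → X₂,
      ((∀ x ∈ S₁.Sig φ₁, g x = f x) ∧
        Set.MapsTo g {z | S₁.InClosure (S₁.Sig φ₁) z} {z | S₂.InClosure (S₂.Sig φ₂) z} ∧
        ContOnWrt S₁ S₂ g {z | S₁.InClosure (S₁.Sig φ₁) z} ∧
        Set.InjOn g {z | S₁.InClosure (S₁.Sig φ₁) z}) ∧
      ∀ g' : X₁ → X₂, (∀ x ∈ S₁.Sig φ₁, g' x = f x) →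
        Set.MapsTo g' {z | S₁.InClosure (S₁.Sig φ₁) z} {z | S₂.InClosure (S₂.Sig φ₂) z} →
        ContOnWrt S₁ S₂ g' {z | S₁.InClosure (S₁.Sig φ₁) z} →
        Set.EqOn g g' {z | S₁.InClosure (S₁.Sig φ₁) z} := by
  let _ : NormedAddCommGroup X₁ :=
    letI : Norm X₁ := ⟨S₁.onorm⟩
    NormedAddCommGroup.ofCore S₁.normedSpaceCore
  let _ : NormedSpace ℝ X₁ :=
    letI : Norm X₁ := ⟨S₁.onorm⟩
    NormedSpace.ofCore S₁.normedSpaceCore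
  let _ : NormedAddCommGroup X₂ :=
    letI : Norm X₂ := ⟨S₂.onorm⟩
    NormedAddCommGroup.ofCore S₂.normedSpaceCore
  let _ : NormedSpace ℝ X₂ :=
    letI : Norm X₂ := ⟨S₂.onorm⟩
    NormedSpace.ofCore S₂.normedSpaceCore
  exact exists_unique_extension_of_onorm_eq_norm (fun _ => rfl) (fun _ => rfl)
    hstate₁ hpos₁ hpos₂ hmaps hiso hseg

end HilbertGeom
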